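/- Let d ≥ 1, let Σ be a positive-definite real d×d matrix with eigendecomposition Σ = Q Λ Qᵀ, and r > 0, and let E_Σ = { x : xᵀ Σ⁻¹ x ≤ r² }. Among all ellipsoids T(E_Σ) obtained from invertible linear maps T : ℝ^d → ℝ^d, the quantity vol(T(E_Σ)) / L(T)^d, where L(T) is the maximal coordinate-wise range of T(E_Σ) (the edge of its smallest axis-aligned enclosing hypercube), is maximized by T = c · Λ^{-1/2} Qᵀ for any c > 0, and the maximal value equals π^{d/2} / (2^d · Γ(d/2 + 1)). -/

import Mathlib

open Matrix MeasureTheory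

/-- The maximal coordinate-wise range of a set `A ⊆ ℝ^d`: the edge length of
the smallest axis-aligned hypercube containing `A`. -/
noncomputable def maxCoordRange (d : ℕ) (A : Set (Fin d → ℝ)) : ℝ :=
  ⨆ i : Fin d, (sSup ((fun x => x i) '' A) - sInf ((fun x => x i) '' A))

/-- Euclidean norm of a row. -/
noncomputable def rowN {d : ℕ} (A : Matrix (Fin d) (Fin d) ℝ) (i : Fin d) : ℝ :=
  Real.sqrt (∑ j, A i j ^ 2)

lemma hadamard_rows {d : ℕ} (A : Matrix (Fin d) (Fin d) ℝ) :
    |A.det| ≤ ∏ i, rowN A i := by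
  have : Fact (Module.finrank ℝ (EuclideanSpace ℝ (Fin d)) = d) := ⟨by simp⟩
  let b := EuclideanSpace.basisFun (Fin d) ℝ
  let o := b.toBasis.orientation
  have h := o.abs_volumeForm_apply_le (fun i => WithLp.toLp 2 (A i))
  rw [o.volumeForm_robust' b, Module.Basis.det_apply] at h
  have h2 : b.toBasis.toMatrix (fun i => WithLp.toLp 2 (A i)) = Aᵀ := by
    ext i j
    simp [b, Module.Basis.toMatrix_apply]
  rw [h2, Matrix.det_transpose] at h
  simpa [EuclideanSpace.norm_eq, rowN] using h

lemma ball_volume {d : ℕ} (hd : 1 ≤ d) (r : ℝ) (hr : 0 < r) :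
    (volume {x : Fin d → ℝ | x ⬝ᵥ x ≤ r ^ 2}).toReal
      = r ^ d * (Real.pi ^ ((d : ℝ) / 2) / Real.Gamma ((d : ℝ) / 2 + 1)) := by
  have hG : 0 < Real.Gamma ((d : ℝ) / 2 + 1) := Real.Gamma_pos_of_pos (by positivity)
  have : Nonempty (Fin d) := ⟨⟨0, hd⟩⟩
  have h := (PiLp.volume_preserving_toLp (Fin d)).measure_preimage
    (s := Metric.closedBall (0 : EuclideanSpace ℝ (Fin d)) r)
    Metric.isClosed_closedBall.measurableSet.nullMeasurableSet
  have hs : (WithLp.toLp 2) ⁻¹' (Metric.closedBall (0 : EuclideanSpace ℝ (Fin d)) r)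
      = {x : Fin d → ℝ | x ⬝ᵥ x ≤ r ^ 2} := by
    ext x
    simp only [Set.mem_preimage, mem_closedBall_zero_iff, Set.mem_ofPred_eq,
      EuclideanSpace.norm_eq, Real.sqrt_le_left hr.le, dotProduct, Real.norm_eq_abs, sq_abs]
    simp only [sq]
  rw [hs, EuclideanSpace.volume_closedBall] at h
  rw [h, ENNReal.toReal_mul, ENNReal.toReal_pow, ENNReal.toReal_ofReal hr.le,
    ENNReal.toReal_ofReal (by simpa using by positivity), Fintype.card_fin]
  congr 2
  rw [Real.sqrt_eq_rpow, ← Real.rpow_natCast, ← Real.rpow_mul Real.pi_pos.le]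
  congr 1
  ring

lemma range_greatest {d : ℕ} (A : Matrix (Fin d) (Fin d) ℝ) (r : ℝ) (hr : 0 < r) (i : Fin d) :
    IsGreatest ((fun x => x i) '' ((fun x => A.mulVec x) '' {x : Fin d → ℝ | x ⬝ᵥ x ≤ r ^ 2}))
      (r * rowN A i) := by
  have hN : rowN A i ^ 2 = ∑ j, A i j ^ 2 :=
    Real.sq_sqrt (Finset.sum_nonneg fun j _ => sq_nonneg _)
  have hN0 : 0 ≤ rowN A i := Real.sqrt_nonneg _
  constructor
  · refine ⟨_, ⟨fun j => r / rowN A i * A i j, ?_, rfl⟩, ?_⟩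
    · have : ∑ j, (r / rowN A i * A i j) * (r / rowN A i * A i j)
          = (r / rowN A i) ^ 2 * rowN A i ^ 2 := by
        rw [hN, Finset.mul_sum]
        exact Finset.sum_congr rfl fun j _ => by ring
      simp only [Set.mem_ofPred_eq, dotProduct, this]
      by_cases h0 : rowN A i = 0
      · simp [h0]; positivity
      · apply le_of_eq; field_simp
    · have : ∑ j, A i j * (r / rowN A i * A i j) = r / rowN A i * rowN A i ^ 2 := by
        rw [hN, Finset.mul_sum]
        exact Finset.sum_congr rfl fun j _ => by ring
      simp only [mulVec, dotProduct, this]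
      by_cases h0 : rowN A i = 0
      · simp [h0]
      · field_simp
  · rintro _ ⟨_, ⟨x, hx, rfl⟩, rfl⟩
    have h := Real.sum_mul_le_sqrt_mul_sqrt Finset.univ (fun j => A i j) x
    have hx' : Real.sqrt (∑ j, x j ^ 2) ≤ r := by
      rw [Real.sqrt_le_left hr.le]
      simpa [dotProduct, sq] using hx
    simp only [mulVec, dotProduct]
    refine h.trans ?_
    rw [mul_comm r]
    exact mul_le_mul_of_nonneg_left hx' hN0

lemma range_least {d : ℕ} (A : Matrix (Fin d) (Fin d) ℝ) (r : ℝ) (hr : 0 < r) (i : Fin d) :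
    IsLeast ((fun x => x i) '' ((fun x => A.mulVec x) '' {x : Fin d → ℝ | x ⬝ᵥ x ≤ r ^ 2}))
      (-(r * rowN A i)) := by
  obtain ⟨⟨_, ⟨x, hx, rfl⟩, h1⟩, h2⟩ := range_greatest A r hr i
  constructor
  · refine ⟨_, ⟨-x, ?_, rfl⟩, ?_⟩
    · simpa using hx
    · rw [← h1]; simp [mulVec_neg]
  · rintro _ ⟨_, ⟨y, hy, rfl⟩, rfl⟩
    have := h2 ⟨_, ⟨-y, by simpa using hy, rfl⟩, rfl⟩
    simp only [mulVec_neg, Pi.neg_apply] at this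
    simp only
    linarith

lemma maxCoordRange_eq {d : ℕ} (A : Matrix (Fin d) (Fin d) ℝ) (r : ℝ) (hr : 0 < r) :
    maxCoordRange d ((fun x => A.mulVec x) '' {x : Fin d → ℝ | x ⬝ᵥ x ≤ r ^ 2})
      = ⨆ i, 2 * r * rowN A i := by
  unfold maxCoordRange
  congr 1
  funext i
  rw [(range_greatest A r hr i).csSup_eq, (range_least A r hr i).csInf_eq]
  ring

lemma image_volume {d : ℕ} (hd : 1 ≤ d) (A : Matrix (Fin d) (Fin d) ℝ) (r : ℝ) (hr : 0 < r) :
    (volume ((fun x => A.mulVec x) '' {x : Fin d → ℝ | x ⬝ᵥ x ≤ r ^ 2})).toReal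
      = |A.det| * (r ^ d * (Real.pi ^ ((d : ℝ) / 2) / Real.Gamma ((d : ℝ) / 2 + 1))) := by
  have h := Measure.addHaar_image_linearMap volume (Matrix.toLin' A)
    {x : Fin d → ℝ | x ⬝ᵥ x ≤ r ^ 2}
  have e : (fun x => A.mulVec x) = ⇑(Matrix.toLin' A) := by
    funext x; simp
  rw [e, h, LinearMap.det_toLin', ENNReal.toReal_mul, ENNReal.toReal_ofReal (abs_nonneg _),
    ball_volume hd r hr]

lemma ellipsoid_image {d : ℕ} (T W M : Matrix (Fin d) (Fin d) ℝ) (hMW : M * W = 1)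
    (S : Matrix (Fin d) (Fin d) ℝ) (hS : S = M * Mᵀ) (r : ℝ) :
    (fun x => T.mulVec x) '' {x : Fin d → ℝ | x ⬝ᵥ S⁻¹.mulVec x ≤ r ^ 2}
      = (fun x => (T * M).mulVec x) '' {x : Fin d → ℝ | x ⬝ᵥ x ≤ r ^ 2} := by
  have hWM : W * M = 1 := mul_eq_one_comm.mp hMW
  have hinv : S⁻¹ = Wᵀ * W := by
    apply Matrix.inv_eq_right_inv
    rw [hS, Matrix.mul_assoc, ← Matrix.mul_assoc Mᵀ, ← Matrix.transpose_mul, hWM]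
    simpa using hMW
  have key : ∀ x, x ⬝ᵥ S⁻¹.mulVec x = W.mulVec x ⬝ᵥ W.mulVec x := by
    intro x
    rw [hinv, ← Matrix.mulVec_mulVec, Matrix.dotProduct_mulVec, Matrix.vecMul_transpose]
  ext y
  constructor
  · rintro ⟨x, hx, rfl⟩
    refine ⟨W.mulVec x, ?_, ?_⟩
    · simpa [key] using hx
    · simp [Matrix.mulVec_mulVec, Matrix.mul_assoc, hMW]
  · rintro ⟨x, hx, rfl⟩
    refine ⟨M.mulVec x, ?_, ?_⟩
    · simpa [key, Matrix.mulVec_mulVec, hWM] using hx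
    · simp [Matrix.mulVec_mulVec]

/-- Let `Σ = Q Λ Qᵀ` be positive definite (`Q` orthogonal, `Λ = diagonal v`,
`v > 0`) and `E_Σ = {x : xᵀ Σ⁻¹ x ≤ r²}`.  Among all images `T(E_Σ)` under
invertible linear maps `T`, the quantity `vol(T(E_Σ)) / L(T)^d` — where `L(T)` is
the maximal coordinate-wise range of `T(E_Σ)` — is at most
`π^{d/2} / (2^d · Γ(d/2+1))`, and this maximum is attained by
`T = c · Λ^{-1/2} Qᵀ` for every `c > 0`. -/
theorem qsur_maximized_by_whitening (d : ℕ) (hd : 1 ≤ d)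
    (Q : Matrix (Fin d) (Fin d) ℝ) (hQ : Q * Qᵀ = 1)
    (v : Fin d → ℝ) (hv : ∀ i, 0 < v i)
    (S : Matrix (Fin d) (Fin d) ℝ) (hS : S = Q * Matrix.diagonal v * Qᵀ)
    (r : ℝ) (hr : 0 < r) :
    (∀ T : Matrix (Fin d) (Fin d) ℝ, IsUnit T.det →
      (volume ((fun x => T.mulVec x) ''
            {x : Fin d → ℝ | x ⬝ᵥ S⁻¹.mulVec x ≤ r ^ 2})).toReal
          / maxCoordRange d ((fun x => T.mulVec x) ''
            {x : Fin d → ℝ | x ⬝ᵥ S⁻¹.mulVec x ≤ r ^ 2}) ^ d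
        ≤ Real.pi ^ ((d : ℝ) / 2) / (2 ^ d * Real.Gamma ((d : ℝ) / 2 + 1))) ∧
    (∀ c : ℝ, 0 < c →
      (volume ((fun x => (c • (Matrix.diagonal (fun i => (Real.sqrt (v i))⁻¹) * Qᵀ)).mulVec x) ''
            {x : Fin d → ℝ | x ⬝ᵥ S⁻¹.mulVec x ≤ r ^ 2})).toReal
          / maxCoordRange d ((fun x => (c • (Matrix.diagonal (fun i => (Real.sqrt (v i))⁻¹) * Qᵀ)).mulVec x) ''
            {x : Fin d → ℝ | x ⬝ᵥ S⁻¹.mulVec x ≤ r ^ 2}) ^ d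
        = Real.pi ^ ((d : ℝ) / 2) / (2 ^ d * Real.Gamma ((d : ℝ) / 2 + 1))) := by
  have hQ' : Qᵀ * Q = 1 := mul_eq_one_comm.mp hQ
  have hs : ∀ i, 0 < Real.sqrt (v i) := fun i => Real.sqrt_pos.mpr (hv i)
  set W := Matrix.diagonal (fun i => (Real.sqrt (v i))⁻¹) * Qᵀ with hW
  set M := Q * Matrix.diagonal (fun i => Real.sqrt (v i)) with hM
  have hWM : W * M = 1 := by
    rw [hW, hM, Matrix.mul_assoc, ← Matrix.mul_assoc Qᵀ, hQ', Matrix.one_mul,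
      Matrix.diagonal_mul_diagonal, ← Matrix.diagonal_one]
    congr 1
    funext i
    exact inv_mul_cancel₀ (hs i).ne'
  have hMW : M * W = 1 := mul_eq_one_comm.mp hWM
  have hSM : S = M * Mᵀ := by
    have hD : Matrix.diagonal v
        = Matrix.diagonal (fun i => Real.sqrt (v i)) * Matrix.diagonal (fun i => Real.sqrt (v i)) := by
      rw [Matrix.diagonal_mul_diagonal]
      congr 1
      funext i
      exact (Real.mul_self_sqrt (hv i).le).symm
    rw [hS, hM, Matrix.transpose_mul, Matrix.diagonal_transpose, hD]
    simp only [Matrix.mul_assoc]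
  have : Nonempty (Fin d) := ⟨⟨0, hd⟩⟩
  have hG : 0 < Real.Gamma ((d : ℝ) / 2 + 1) := Real.Gamma_pos_of_pos (by positivity)
  have hP : 0 < Real.pi ^ ((d : ℝ) / 2) := Real.rpow_pos_of_pos Real.pi_pos _
  constructor
  · intro T hT
    rw [ellipsoid_image T W M hMW S hSM r, image_volume hd _ r hr, maxCoordRange_eq _ r hr]
    set A := T * M
    have hA : 0 < |A.det| := by
      rw [abs_pos, Matrix.det_mul]
      refine mul_ne_zero hT.ne_zero ?_
      intro h0
      have := congrArg Matrix.det hMW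
      rw [Matrix.det_mul, h0] at this
      simp at this
    set L := ⨆ i, 2 * r * rowN A i
    have hle : ∀ i, rowN A i ≤ L / (2 * r) := by
      intro i
      rw [le_div_iff₀ (by positivity), mul_comm]
      exact le_ciSup (f := fun i => 2 * r * rowN A i) (Set.finite_range _).bddAbove i
    have hdet : |A.det| ≤ (L / (2 * r)) ^ d := by
      refine (hadamard_rows A).trans ?_
      refine (Finset.prod_le_prod (fun i _ => Real.sqrt_nonneg _) (fun i _ => hle i)).trans ?_
      simp [div_pow]
    have hL0 : 0 ≤ L := Real.iSup_nonneg fun i => by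
      have : 0 ≤ rowN A i := Real.sqrt_nonneg _
      positivity
    have hL : 0 < L ^ d := by
      have := hA.trans_le hdet
      rw [div_pow] at this
      by_contra hn
      have h0 : L ^ d = 0 := le_antisymm (not_lt.mp hn) (by positivity)
      simp [h0] at this
    rw [div_le_iff₀ hL]
    calc _ ≤ (L / (2 * r)) ^ d * (r ^ d * (Real.pi ^ ((d : ℝ) / 2) / Real.Gamma ((d : ℝ) / 2 + 1))) :=
          mul_le_mul_of_nonneg_right hdet (by positivity)
      _ = _ := by
          rw [div_pow, mul_pow]
          field_simp
  · intro c hc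
    rw [ellipsoid_image _ W M hMW S hSM r, image_volume hd _ r hr, maxCoordRange_eq _ r hr,
      Matrix.smul_mul, hWM]
    have hrow : ∀ i, rowN (c • (1 : Matrix (Fin d) (Fin d) ℝ)) i = c := by
      intro i
      simp [rowN, Matrix.one_apply, Real.sqrt_sq hc.le]
    simp only [hrow, ciSup_const, Matrix.det_smul, Matrix.det_one, mul_one, Fintype.card_fin]
    rw [abs_of_pos (by positivity), mul_pow, mul_pow]
    field_simp
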